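/- arXiv:1306.2725 — 4 statements merged into one kernel-verified Lean document; each statement's English description precedes it below -/
import Mathlib

section
/- Every finite simple graph with maximum degree at most 3 has a proper edge coloring using at most 4 colors; consequently the chromatic index of a cubic simple graph is either 3 or 4. -/
/-- A proper edge coloring: distinct edges of `G` sharing an endpoint get different colors. -/
def IsProperEdgeColoring {V γ : Type*} (G : SimpleGraph V) (c : Sym2 V → γ) : Prop :=
  ∀ e₁ ∈ G.edgeSet, ∀ e₂ ∈ G.edgeSet, e₁ ≠ e₂ → (∃ v, v ∈ e₁ ∧ v ∈ e₂) → c e₁ ≠ c e₂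

/-- The chromatic index: the least `k` such that `G` has a proper edge coloring with `k` colors. -/
noncomputable def chromaticIndex {V : Type*} (G : SimpleGraph V) : ℕ :=
  sInf {k : ℕ | ∃ c : Sym2 V → Fin k, IsProperEdgeColoring G c}

namespace SimpleGraph

variable {V K : Type*} {G : SimpleGraph V} {c : Sym2 V → K}

/-- No edge of `G` at `a` has the color `x` under `c`. -/
def IsMissingColor (G : SimpleGraph V) (c : Sym2 V → K) (a : V) (x : K) : Prop :=
  ∀ b, G.Adj a b → c s(a, b) ≠ x

theorem isProperEdgeColoring_iff :
    IsProperEdgeColoring G c ↔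
      ∀ a b b', G.Adj a b → G.Adj a b' → c s(a, b) = c s(a, b') → b = b' := by
  constructor
  · intro h a b b' hb hb' hc
    by_contra hne
    refine h s(a, b) hb s(a, b') hb' ?_ ⟨a, by simp, by simp⟩ hc
    exact fun h ↦ hne (Sym2.congr_right.1 h)
  · rintro h e₁ h₁ e₂ h₂ hne ⟨a, ha₁, ha₂⟩ hc
    obtain ⟨b, rfl⟩ := ha₁
    obtain ⟨b', rfl⟩ := ha₂
    exact hne (by rw [h a b b' h₁ h₂ hc])

/-- In a finite graph with at most two neighbors per vertex, a connected component contains at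
most two vertices with at most one neighbor. -/
theorem not_reachable_or_not_reachable [Finite V] (H : SimpleGraph V)
    (hH : ∀ a, (H.neighborSet a).ncard ≤ 2) {u p q : V} (hup : u ≠ p) (huq : u ≠ q) (hpq : p ≠ q)
    (hu : (H.neighborSet u).ncard ≤ 1) (hp : (H.neighborSet p).ncard ≤ 1)
    (hq : (H.neighborSet q).ncard ≤ 1) : ¬ H.Reachable u p ∨ ¬ H.Reachable u q := by
  classical
  by_contra! hreach
  obtain ⟨hrp, hrq⟩ := hreach
  let C := H.connectedComponentMk u
  have : Fintype C := Fintype.ofFinite C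
  have hdeg : ∀ a : C, C.toSimpleGraph.degree a ≤ (H.neighborSet a).ncard := by
    intro a
    rw [← card_neighborSet_eq_degree, ← Nat.card_eq_fintype_card, Nat.card_coe_set_eq,
      ← Set.ncard_image_of_injective _ Subtype.val_injective]
    refine Set.ncard_le_ncard ?_ (Set.toFinite _)
    rintro _ ⟨b, hb, rfl⟩
    exact hb
  let T : Finset C := {⟨u, rfl⟩, ⟨p, ConnectedComponent.sound hrp.symm⟩,
    ⟨q, ConnectedComponent.sound hrq.symm⟩}
  have hT : T.card = 3 := Finset.card_eq_three.2
    ⟨_, _, _, fun h ↦ hup (congrArg Subtype.val h),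
      fun h ↦ huq (congrArg Subtype.val h), fun h ↦ hpq (congrArg Subtype.val h), rfl⟩
  have hdegT : ∀ a : C, C.toSimpleGraph.degree a + (if a ∈ T then 1 else 0) ≤ 2 := by
    intro a
    split_ifs with ha
    · have ha' : (a : V) = u ∨ (a : V) = p ∨ (a : V) = q := by
        simpa [T, Subtype.ext_iff] using ha
      have : (H.neighborSet a).ncard ≤ 1 := by
        rcases ha' with h | h | h <;> rwa [h]
      have := hdeg a
      omega
    · exact (hdeg a).trans (hH a)
  have hsum := Finset.sum_le_sum fun a (_ : a ∈ Finset.univ) ↦ hdegT a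
  rw [Finset.sum_add_distrib, sum_degrees_eq_twice_card_edges, Finset.sum_ite_mem,
    Finset.univ_inter, Finset.sum_const, hT, Finset.sum_const, Finset.card_univ] at hsum
  have htree := C.connected_toSimpleGraph.card_vert_le_card_edgeSet_add_one
  rw [Nat.card_eq_fintype_card, Nat.card_eq_fintype_card, ← edgeFinset_card] at htree
  simp only [smul_eq_mul] at hsum
  omega

/-- The colors `α` and `β` can be exchanged inside a union `S` of components of the subgraph formed
by the edges of these colors. -/
theorem exists_swap_colors [DecidableEq K] (hc : IsProperEdgeColoring G c) (α β : K) (S : Set V)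
    (hS : ∀ a b, G.Adj a b → c s(a, b) = α ∨ c s(a, b) = β → (a ∈ S → b ∈ S)) :
    ∃ c' : Sym2 V → K, IsProperEdgeColoring G c' ∧
      (∀ a ∈ S, ∀ b, G.Adj a b → c' s(a, b) = Equiv.swap α β (c s(a, b))) ∧
      (∀ a ∉ S, ∀ b, G.Adj a b → c' s(a, b) = c s(a, b)) := by
  classical
  let c' : Sym2 V → K := fun e ↦ if ∃ a ∈ e, a ∈ S then Equiv.swap α β (c e) else c e
  have h_in : ∀ a ∈ S, ∀ b, G.Adj a b → c' s(a, b) = Equiv.swap α β (c s(a, b)) := by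
    intro a ha b _
    exact if_pos ⟨a, by simp, ha⟩
  have h_out : ∀ a ∉ S, ∀ b, G.Adj a b → c' s(a, b) = c s(a, b) := by
    intro a ha b hab
    by_cases hb : b ∈ S
    · have hcol : ¬ (c s(a, b) = α ∨ c s(a, b) = β) := fun h ↦
        ha (hS b a hab.symm (by rwa [Sym2.eq_swap]) hb)
      rw [not_or] at hcol
      change (if _ then _ else _) = _
      rw [Equiv.swap_apply_of_ne_of_ne hcol.1 hcol.2, ite_self]
    · refine if_neg ?_
      simp [ha, hb]
  refine ⟨c', ?_, h_in, h_out⟩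
  rw [isProperEdgeColoring_iff] at hc ⊢
  intro a b b' hb hb' h
  by_cases ha : a ∈ S
  · rw [h_in a ha b hb, h_in a ha b' hb'] at h
    exact hc a b b' hb hb' ((Equiv.swap α β).injective h)
  · refine hc a b b' hb hb' ?_
    rwa [h_out a ha b hb, h_out a ha b' hb'] at h

/-- If each of three vertices misses `α` or `β`, then `α` and `β` can be exchanged around the first
of them while leaving one of the other two untouched. -/
theorem exists_kempe_set [Finite V] (hc : IsProperEdgeColoring G c) (α β : K) {u p q : V}
    (hup : u ≠ p) (huq : u ≠ q) (hpq : p ≠ q)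
    (hu : G.IsMissingColor c u α ∨ G.IsMissingColor c u β)
    (hp : G.IsMissingColor c p α ∨ G.IsMissingColor c p β)
    (hq : G.IsMissingColor c q α ∨ G.IsMissingColor c q β) :
    ∃ S : Set V, u ∈ S ∧ (p ∉ S ∨ q ∉ S) ∧
      ∀ a b, G.Adj a b → c s(a, b) = α ∨ c s(a, b) = β → (a ∈ S → b ∈ S) := by
  let H : SimpleGraph V :=
    { Adj := fun a b ↦ G.Adj a b ∧ (c s(a, b) = α ∨ c s(a, b) = β)
      symm := ⟨fun a b h ↦ ⟨h.1.symm, by rw [Sym2.eq_swap]; exact h.2⟩⟩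
      loopless := ⟨fun a h ↦ G.loopless.irrefl a h.1⟩ }
  rw [isProperEdgeColoring_iff] at hc
  have hinj : ∀ a, Set.InjOn (fun b ↦ c s(a, b)) (H.neighborSet a) :=
    fun a b hb b' hb' h ↦ hc a b b' hb.1 hb'.1 h
  have hH : ∀ a, (H.neighborSet a).ncard ≤ 2 := by
    intro a
    rw [← (hinj a).ncard_image]
    refine (Set.ncard_le_ncard (t := {α, β}) ?_ (Set.toFinite _)).trans
      ((Set.ncard_insert_le _ _).trans (by simp))
    rintro _ ⟨b, hb, rfl⟩
    exact hb.2
  have hend : ∀ a, G.IsMissingColor c a α ∨ G.IsMissingColor c a β →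
      (H.neighborSet a).ncard ≤ 1 := by
    intro a ha
    rw [← (hinj a).ncard_image]
    rcases ha with ha | ha
    · refine (Set.ncard_le_ncard (t := {β}) ?_ (Set.toFinite _)).trans (Set.ncard_singleton β).le
      rintro _ ⟨b, hb, rfl⟩
      exact hb.2.resolve_left (ha b hb.1)
    · refine (Set.ncard_le_ncard (t := {α}) ?_ (Set.toFinite _)).trans (Set.ncard_singleton α).le
      rintro _ ⟨b, hb, rfl⟩
      exact hb.2.resolve_right (ha b hb.1)
  refine ⟨{a | H.Reachable u a}, Reachable.refl u,
    H.not_reachable_or_not_reachable hH hup huq hpq (hend u hu) (hend p hp) (hend q hq), ?_⟩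
  intro a b hab hcol ha
  exact ha.trans (Adj.reachable (G := H) ⟨hab, hcol⟩)

/-- An edge can be (re)colored with a color missing at both of its ends. -/
theorem _root_.IsProperEdgeColoring.update [DecidableEq V] {u v : V} {x : K}
    (hc : IsProperEdgeColoring (G.deleteEdges {s(u, v)}) c)
    (hu : (G.deleteEdges {s(u, v)}).IsMissingColor c u x)
    (hv : (G.deleteEdges {s(u, v)}).IsMissingColor c v x) :
    IsProperEdgeColoring G (Function.update c s(u, v) x) := by
  rw [isProperEdgeColoring_iff] at hc ⊢
  have hmiss : ∀ a b b', s(a, b) = s(u, v) → s(a, b') ≠ s(u, v) → G.Adj a b' →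
      c s(a, b') ≠ x := by
    intro a b b' h h' hb'
    rcases Sym2.eq_iff.1 h with ⟨rfl, rfl⟩ | ⟨rfl, rfl⟩
    · exact hu b' (deleteEdges_adj.2 ⟨hb', h'⟩)
    · exact hv b' (deleteEdges_adj.2 ⟨hb', h'⟩)
  intro a b b' hb hb' h
  by_cases h₁ : s(a, b) = s(u, v) <;> by_cases h₂ : s(a, b') = s(u, v)
  · exact Sym2.congr_right.1 (h₁.trans h₂.symm)
  · rw [h₁, Function.update_self, Function.update_of_ne h₂] at h
    exact absurd h.symm (hmiss a b b' h₁ h₂ hb')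
  · rw [h₂, Function.update_self, Function.update_of_ne h₁] at h
    exact absurd h (hmiss a b' b h₂ h₁ hb)
  · rw [Function.update_of_ne h₁, Function.update_of_ne h₂] at h
    exact hc a b b' (deleteEdges_adj.2 ⟨hb, h₁⟩) (deleteEdges_adj.2 ⟨hb', h₂⟩) h

theorem _root_.IsProperEdgeColoring.anti {H : SimpleGraph V} (hHG : H ≤ G)
    (hc : IsProperEdgeColoring G c) : IsProperEdgeColoring H c :=
  fun e₁ h₁ e₂ h₂ ↦ hc e₁ (edgeSet_mono hHG h₁) e₂ (edgeSet_mono hHG h₂)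

theorem IsMissingColor.anti {H : SimpleGraph V} {a : V} {x : K} (hHG : H ≤ G)
    (h : G.IsMissingColor c a x) : H.IsMissingColor c a x :=
  fun b hb ↦ h b (hHG hb)

/-- Shifting the color `γ` from `uw` to the uncolored edge `uv`, after recoloring `uw` by `ε`. -/
theorem _root_.IsProperEdgeColoring.exists_shift {u v w : V} {γ ε : K}
    (hc : IsProperEdgeColoring (G.deleteEdges {s(u, v)}) c) (hne : u ≠ v)
    (huw : (G.deleteEdges {s(u, v)}).Adj u w) (hγ : c s(u, w) = γ)
    (hv : (G.deleteEdges {s(u, v)}).IsMissingColor c v γ)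
    (hu : (G.deleteEdges {s(u, v)}).IsMissingColor c u ε)
    (hw : (G.deleteEdges {s(u, v)}).IsMissingColor c w ε) :
    ∃ c' : Sym2 V → K, IsProperEdgeColoring G c' := by
  classical
  have hvw : v ≠ w := by
    rintro rfl
    simp [deleteEdges_adj] at huw
  have hle := (G.deleteEdges {s(u, v)}).deleteEdges_le {s(u, w)}
  refine ⟨_, ((hc.anti hle).update (hu.anti hle) (hw.anti hle)).update (x := γ) ?_ ?_⟩
  · intro b hb
    by_cases hbw : b = w
    · subst hbw
      rw [Function.update_self]
      exact fun h ↦ hu b huw (hγ.trans h.symm)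
    · rw [Function.update_of_ne (fun h ↦ hbw (Sym2.congr_right.1 h))]
      exact fun h ↦ hbw (isProperEdgeColoring_iff.1 hc u b w hb huw (h.trans hγ.symm))
  · intro b hb
    rw [Function.update_of_ne]
    · exact hv b hb
    · intro h
      rcases Sym2.eq_iff.1 h with ⟨h, -⟩ | ⟨h, -⟩
      · exact hne h.symm
      · exact hvw h

theorem le_ncard_missing_add_ncard_neighborSet [Finite V] [Finite K] (a : V) :
    Nat.card K ≤ {x | G.IsMissingColor c a x}.ncard + (G.neighborSet a).ncard := by
  have himage : {x | G.IsMissingColor c a x}ᶜ ⊆ (fun b ↦ c s(a, b)) '' G.neighborSet a := by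
    intro x hx
    simpa [IsMissingColor] using hx
  have h₁ := Set.ncard_le_ncard himage (Set.toFinite _)
  have h₂ := Set.ncard_image_le (f := fun b ↦ c s(a, b)) (Set.toFinite (G.neighborSet a))
  have h₃ := Set.ncard_add_ncard_compl {x | G.IsMissingColor c a x}
  omega

theorem exists_edgeColoring_of_deleteEdges [Finite V]
    (hG : ∀ a, (G.neighborSet a).ncard ≤ 3) {u v : V} (huv : G.Adj u v) {c : Sym2 V → Fin 4}
    (hc : IsProperEdgeColoring (G.deleteEdges {s(u, v)}) c) :
    ∃ c' : Sym2 V → Fin 4, IsProperEdgeColoring G c' := by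
  classical
  set G' := G.deleteEdges {s(u, v)} with hG'
  let M (a : V) : Set (Fin 4) := {x | G'.IsMissingColor c a x}
  have hle : G' ≤ G := deleteEdges_le _
  have hdeg : ∀ a b, G.Adj a b → ¬ G'.Adj a b → 2 ≤ (M a).ncard := by
    intro a b hab hab'
    have hlt : (G'.neighborSet a).ncard < (G.neighborSet a).ncard :=
      Set.ncard_lt_ncard ((Set.ssubset_iff_of_subset fun _ h ↦ hle h).2 ⟨b, hab, hab'⟩)
        (Set.toFinite _)
    have h₁ := hG a
    have h₂ := G'.le_ncard_missing_add_ncard_neighborSet (c := c) a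
    rw [Nat.card_fin] at h₂
    change 4 ≤ (M a).ncard + _ at h₂
    omega
  have hMu : 2 ≤ (M u).ncard := hdeg u v huv (by simp [hG', deleteEdges_adj])
  have hMv : 2 ≤ (M v).ncard := hdeg v u huv.symm (by simp [hG', deleteEdges_adj])
  by_cases hdisj : Disjoint (M u) (M v)
  swap
  · obtain ⟨x, hxu, hxv⟩ := Set.not_disjoint_iff.1 hdisj
    exact ⟨_, hc.update hxu hxv⟩
  have hcover : ∀ x, x ∈ M u ∨ x ∈ M v := by
    have hcard := Set.ncard_union_eq hdisj (Set.toFinite _) (Set.toFinite _)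
    have huniv : M u ∪ M v = Set.univ := by
      refine Set.eq_of_subset_of_ncard_le (Set.subset_univ _) ?_
      rw [Set.ncard_univ, Nat.card_fin]
      omega
    exact fun x ↦ huniv.superset (Set.mem_univ x)
  obtain ⟨α, hα⟩ : (M u).Nonempty := Set.nonempty_of_ncard_ne_zero (by omega)
  obtain ⟨γ, hγ⟩ : (M v).Nonempty := Set.nonempty_of_ncard_ne_zero (by omega)
  obtain ⟨w, huw, hwγ⟩ : ∃ w, G'.Adj u w ∧ c s(u, w) = γ := by
    have : γ ∉ M u := fun h ↦ Set.disjoint_left.1 hdisj h hγ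
    simpa [M, IsMissingColor] using this
  obtain ⟨ε, hε⟩ : (M w).Nonempty := by
    refine Set.nonempty_of_ncard_ne_zero fun h₀ ↦ ?_
    have h₁ := hG w
    have h₂ := G'.le_ncard_missing_add_ncard_neighborSet (c := c) w
    rw [Nat.card_fin] at h₂
    change 4 ≤ (M w).ncard + _ at h₂
    have h₃ := Set.ncard_le_ncard (s := G'.neighborSet w) (t := G.neighborSet w)
      (fun _ h ↦ hle h) (Set.toFinite _)
    omega
  rcases hcover ε with hεu | hεv
  · exact hc.exists_shift huv.ne huw hwγ hγ hεu hε
  have hvw : v ≠ w := by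
    rintro rfl
    simp [hG', deleteEdges_adj] at huw
  have hγα : γ ≠ α := fun h ↦ Set.disjoint_left.1 hdisj hα (h ▸ hγ)
  have hγε : γ ≠ ε := fun h ↦ hε u huw.symm (by rw [Sym2.eq_swap, hwγ, h])
  obtain ⟨S, huS, hvwS, hS⟩ := G'.exists_kempe_set hc α ε huv.ne huw.ne hvw
    (Or.inl hα) (Or.inr hεv) (Or.inr hε)
  obtain ⟨c', hc', h_in, h_out⟩ := exists_swap_colors hc α ε S hS
  have hεu' : G'.IsMissingColor c' u ε := by
    intro b hb h
    rw [h_in u huS b hb, Equiv.swap_apply_eq_iff, Equiv.swap_apply_right] at h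
    exact hα b hb h
  have hout' : ∀ a ∉ S, G'.IsMissingColor c a ε → G'.IsMissingColor c' a ε := by
    intro a ha h b hb
    rw [h_out a ha b hb]
    exact h b hb
  rcases hvwS with hvS | hwS
  · exact ⟨_, hc'.update hεu' (hout' v hvS hεv)⟩
  · refine hc'.exists_shift huv.ne huw (γ := γ) ?_ ?_ hεu' (hout' w hwS hε)
    · rw [h_in u huS w huw, hwγ, Equiv.swap_apply_of_ne_of_ne hγα hγε]
    · intro b hb h
      by_cases hv : v ∈ S
      · rw [h_in v hv b hb, Equiv.swap_apply_eq_iff, Equiv.swap_apply_of_ne_of_ne hγα hγε] at h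
        exact hγ b hb h
      · rw [h_out v hv b hb] at h
        exact hγ b hb h

theorem exists_edgeColoring_fin_four [Finite V] (G : SimpleGraph V)
    (hG : ∀ a, (G.neighborSet a).ncard ≤ 3) :
    ∃ c : Sym2 V → Fin 4, IsProperEdgeColoring G c := by
  induction G using WellFoundedLT.induction with
  | ind G ih =>
    by_cases hbot : G = ⊥
    · subst hbot
      exact ⟨fun _ ↦ 0, fun e he ↦ by simp at he⟩
    obtain ⟨u, v, huv⟩ := ne_bot_iff_exists_adj.1 hbot
    have hlt : G.deleteEdges {s(u, v)} < G := by
      refine lt_of_le_of_ne (deleteEdges_le _) fun h ↦ ?_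
      rw [← h, deleteEdges_adj] at huv
      exact huv.2 rfl
    obtain ⟨c, hc⟩ := ih _ hlt fun a ↦
      (Set.ncard_le_ncard (fun _ h ↦ hlt.le h) (Set.toFinite _)).trans (hG a)
    exact exists_edgeColoring_of_deleteEdges hG huv hc

theorem _root_.IsProperEdgeColoring.ncard_neighborSet_le [Finite K] (hc : IsProperEdgeColoring G c)
    (a : V) : (G.neighborSet a).ncard ≤ Nat.card K := by
  have hinj : Set.InjOn (fun b ↦ c s(a, b)) (G.neighborSet a) :=
    fun b hb b' hb' h ↦ isProperEdgeColoring_iff.1 hc a b b' hb hb' h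
  rw [← hinj.ncard_image]
  exact Set.ncard_le_card _

end SimpleGraph

/-- Every finite simple graph with maximum degree at most 3 has a proper edge coloring with at
most 4 colors; consequently the chromatic index of a cubic simple graph is either 3 or 4. -/
theorem vizing_maxDegree_three {V : Type*} [Fintype V] [Nonempty V]
    (G : SimpleGraph V) [DecidableRel G.Adj] :
    ((∀ v : V, G.degree v ≤ 3) → ∃ c : Sym2 V → Fin 4, IsProperEdgeColoring G c) ∧
    ((∀ v : V, G.degree v = 3) → chromaticIndex G = 3 ∨ chromaticIndex G = 4) := by
  have hncard : ∀ v, (G.neighborSet v).ncard = G.degree v := fun v ↦ by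
    rw [← G.card_neighborSet_eq_degree, Set.ncard_eq_toFinset_card', Set.toFinset_card]
  have hcol : (∀ v : V, G.degree v ≤ 3) → ∃ c : Sym2 V → Fin 4, IsProperEdgeColoring G c :=
    fun h ↦ G.exists_edgeColoring_fin_four fun v ↦ (hncard v).trans_le (h v)
  refine ⟨hcol, fun h ↦ ?_⟩
  have hfour := hcol fun v ↦ (h v).le
  have hle : chromaticIndex G ≤ 4 := Nat.sInf_le hfour
  obtain ⟨c, hc⟩ : ∃ c : Sym2 V → Fin (chromaticIndex G), IsProperEdgeColoring G c :=
    Nat.sInf_mem (s := {k : ℕ | ∃ c : Sym2 V → Fin k, IsProperEdgeColoring G c}) ⟨4, hfour⟩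
  have hge := hc.ncard_neighborSet_le (Classical.arbitrary V)
  rw [hncard, h, Nat.card_fin] at hge
  omega
end

section
/- Let G be a finite simple graph with a proper edge coloring, let α and β be two distinct colors, and let H be a connected component of the subgraph of G consisting of all edges colored α or β. Then the coloring obtained from the original one by exchanging the colors α and β on all edges of H (and leaving all other edges unchanged) is again a proper edge coloring of G. -/
/-- Two endpoints of a common edge are reachable from each other. -/
theorem SimpleGraph.reachable_of_mem_edgeSet {V : Type*} {H : SimpleGraph V} {e : Sym2 V}
    (he : e ∈ H.edgeSet) {v w : V} (hv : v ∈ e) (hw : w ∈ e) : H.Reachable v w := by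
  by_cases h : v = w
  · exact h ▸ SimpleGraph.Reachable.refl v
  · rw [(Sym2.mem_and_mem_iff h).1 ⟨hv, hw⟩, SimpleGraph.mem_edgeSet] at he
    exact he.reachable

/-- Kempe chain color exchange: given a proper edge coloring `c` of a finite simple graph `G`,
two distinct colors `a, b`, and the connected component (through a vertex `v₀`) of the
subgraph `H` of edges colored `a` or `b`, swapping `a` and `b` on all edges of that component
(and leaving all other edges unchanged) again yields a proper edge coloring of `G`. -/
theorem kempe_exchange_is_proper
    {V γ : Type*} [Fintype V] [DecidableEq γ] (G : SimpleGraph V)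
    (c : Sym2 V → γ) (hc : IsProperEdgeColoring G c)
    (a b : γ) (hab : a ≠ b)
    (H : SimpleGraph V)
    (hH : H = SimpleGraph.fromEdgeSet {e | e ∈ G.edgeSet ∧ (c e = a ∨ c e = b)})
    (v₀ : V)
    (c' : Sym2 V → γ)
    (hswap : ∀ e ∈ H.edgeSet, (∃ w, w ∈ e ∧ H.Reachable v₀ w) →
      c' e = Equiv.swap a b (c e))
    (hkeep : ∀ e : Sym2 V, ¬ (e ∈ H.edgeSet ∧ ∃ w, w ∈ e ∧ H.Reachable v₀ w) →
      c' e = c e) :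
    IsProperEdgeColoring G c' := by
  have mem_H (e : Sym2 V) : e ∈ H.edgeSet ↔ e ∈ G.edgeSet ∧ (c e = a ∨ c e = b) := by
    rw [hH, SimpleGraph.edgeSet_fromEdgeSet]
    constructor
    · exact fun h => h.1
    · exact fun h => ⟨h, G.not_isDiag_of_mem_edgeSet h.1⟩
  have swap_of_reachable {e : Sym2 V} {v : V} (he : e ∈ G.edgeSet) (hv : v ∈ e)
      (hr : H.Reachable v₀ v) : c' e = Equiv.swap a b (c e) := by
    by_cases h : e ∈ H.edgeSet
    · exact hswap e h ⟨v, hv, hr⟩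
    · have hne : ¬(c e = a ∨ c e = b) := fun h' => h ((mem_H e).2 ⟨he, h'⟩)
      rw [not_or] at hne
      rw [hkeep e fun h' => h h'.1, Equiv.swap_apply_of_ne_of_ne hne.1 hne.2]
  have keep_of_not_reachable {e : Sym2 V} {v : V} (hv : v ∈ e)
      (hr : ¬H.Reachable v₀ v) : c' e = c e :=
    hkeep e fun ⟨h, _, hw, hrw⟩ =>
      hr (hrw.trans (SimpleGraph.reachable_of_mem_edgeSet h hw hv))
  rintro e₁ he₁ e₂ he₂ hne ⟨v, hv₁, hv₂⟩
  have hcne := hc e₁ he₁ e₂ he₂ hne ⟨v, hv₁, hv₂⟩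
  by_cases hr : H.Reachable v₀ v
  · rw [swap_of_reachable he₁ hv₁ hr, swap_of_reachable he₂ hv₂ hr]
    exact (Equiv.swap a b).injective.ne hcne
  · rwa [keep_of_not_reachable hv₁ hr, keep_of_not_reachable hv₂ hr]
end

section
/- The Petersen graph is the smallest snark: every bridgeless cubic simple graph with fewer than 10 vertices is 3-edge-colorable. -/
namespace CubicEdgeColoring

/-- `v` is an endpoint of the edge `e`, given as a pair of natural numbers. -/
def incident (v : ℕ) (e : ℕ × ℕ) : Bool := e.1 == v || e.2 == v

/-- The edges `e` and `f` share an endpoint. -/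
def touch (e f : ℕ × ℕ) : Bool := incident e.1 f || incident e.2 f

/-- The number of edges in the list `es` incident to `v`. -/
def deg (v : ℕ) (es : List (ℕ × ℕ)) : ℕ := es.countP (incident v)

/-- The graph whose edges are listed in `es` has a proper 3-edge-coloring. -/
def EdgeColorable (es : List (ℕ × ℕ)) : Prop :=
  ∃ c : ℕ × ℕ → Fin 3, ∀ e ∈ es, ∀ f ∈ es, e ≠ f → touch e f → c e ≠ c f

theorem touch_comm (e f : ℕ × ℕ) : touch e f = touch f e := by
  rw [Bool.eq_iff_iff]
  simp only [touch, incident, Bool.or_eq_true, beq_iff_eq]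
  grind

theorem EdgeColorable.mono {es fs : List (ℕ × ℕ)} (h : EdgeColorable fs) (hs : es ⊆ fs) :
    EdgeColorable es := by
  obtain ⟨c, hc⟩ := h
  exact ⟨c, fun e he f hf => hc e (hs he) f (hs hf)⟩

/-- Backtracking search for a proper 3-edge-coloring of `es` compatible with the edges already
colored in `cs`. -/
def colorSearch : List (ℕ × ℕ) → List ((ℕ × ℕ) × Fin 3) → Bool
  | [], _ => true
  | e :: es, cs => [0, 1, 2].any fun k =>
      cs.all (fun f => !(touch e f.1 && f.2 == k)) && colorSearch es ((e, k) :: cs)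

theorem exists_coloring_of_colorSearch (es : List (ℕ × ℕ)) (cs : List ((ℕ × ℕ) × Fin 3))
    (h : colorSearch es cs) :
    ∃ c : ℕ × ℕ → Fin 3, (∀ e ∈ es, ∀ f ∈ es, e ≠ f → touch e f → c e ≠ c f) ∧
      ∀ e ∈ es, ∀ f ∈ cs, touch e f.1 → f.2 ≠ c e := by
  induction es generalizing cs with
  | nil => exact ⟨fun _ => 0, by simp, by simp⟩
  | cons e es ih =>
    rw [colorSearch, List.any_eq_true] at h
    obtain ⟨k, -, hk⟩ := h
    rw [Bool.and_eq_true, List.all_eq_true] at hk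
    obtain ⟨hk, hes⟩ := hk
    obtain ⟨c, hc, hcs⟩ := ih _ hes
    have hk' : ∀ f ∈ cs, touch e f.1 → f.2 ≠ k := by
      intro f hf ht he
      simpa [ht, he] using hk f hf
    have hek : ∀ f ∈ es, touch f e → k ≠ c f := fun f hf => hcs f hf (e, k) (by simp)
    refine ⟨Function.update c e k, fun a ha b hb hab ht => ?_, fun a ha f hf ht => ?_⟩
    · rcases eq_or_ne a e with rfl | hae
      · rw [Function.update_self, Function.update_of_ne hab.symm]
        exact hek b ((List.mem_cons.1 hb).resolve_left hab.symm) (touch_comm a b ▸ ht)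
      · have ha' := (List.mem_cons.1 ha).resolve_left hae
        rcases eq_or_ne b e with rfl | hbe
        · rw [Function.update_self, Function.update_of_ne hae]
          exact (hek a ha' ht).symm
        · rw [Function.update_of_ne hae, Function.update_of_ne hbe]
          exact hc a ha' b ((List.mem_cons.1 hb).resolve_left hbe) hab ht
    · rcases eq_or_ne a e with rfl | hae
      · rw [Function.update_self]
        exact hk' f hf ht
      · rw [Function.update_of_ne hae]
        exact hcs a ((List.mem_cons.1 ha).resolve_left hae) f (List.mem_cons_of_mem _ hf) ht

theorem edgeColorable_of_colorSearch {es : List (ℕ × ℕ)} (h : colorSearch es []) :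
    EdgeColorable es := by
  obtain ⟨c, hc, -⟩ := exists_coloring_of_colorSearch es [] h
  exact ⟨c, hc⟩

/-- Checks that every cubic graph obtained by adding to `es` some of the pairs in `ps` is
3-edge-colorable. A branch is pruned as soon as an endpoint of the current pair cannot get
degree 3 any more. -/
def searchAll : List (ℕ × ℕ) → List (ℕ × ℕ) → Bool
  | [], es => colorSearch es []
  | p :: ps, es =>
      (Nat.blt (deg p.1 es + deg p.1 ps) 3 || Nat.blt (deg p.2 es + deg p.2 ps) 3 ||
        searchAll ps es) &&
      (Nat.blt 2 (deg p.1 es) || Nat.blt 2 (deg p.2 es) || searchAll ps (p :: es))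

theorem edgeColorable_of_searchAll (A : ℕ × ℕ → Bool) (ps es : List (ℕ × ℕ))
    (h : searchAll ps es)
    (hdeg : ∀ p ∈ ps, deg p.1 (ps.filter A ++ es) = 3 ∧ deg p.2 (ps.filter A ++ es) = 3) :
    EdgeColorable (ps.filter A ++ es) := by
  induction ps generalizing es with
  | nil => exact edgeColorable_of_colorSearch h
  | cons p ps ih =>
    simp only [searchAll, Bool.and_eq_true, Bool.or_eq_true, Nat.blt_eq] at h
    have hp := hdeg p List.mem_cons_self
    cases hA : A p with
    | false =>
      rw [List.filter_cons_of_neg (by simp [hA])] at hdeg hp ⊢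
      have hle (v : ℕ) : deg v (ps.filter A ++ es) ≤ deg v es + deg v ps := by
        rw [deg, List.countP_append, add_comm]
        exact Nat.add_le_add_left (List.filter_sublist.countP_le) _
      have h₁ := hle p.1
      have h₂ := hle p.2
      exact ih es (by rcases h.1 with (h | h) | h <;> first | exact h | omega)
        fun q hq => hdeg q (List.mem_cons_of_mem _ hq)
    | true =>
      rw [List.filter_cons_of_pos hA] at hdeg hp ⊢
      have hperm : (ps.filter A ++ p :: es).Perm (p :: ps.filter A ++ es) := List.perm_middle
      have hle (v : ℕ) (hv : incident v p) :
          deg v es + 1 ≤ deg v (p :: ps.filter A ++ es) := by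
        rw [deg, deg, List.cons_append, List.countP_cons_of_pos hv, List.countP_append]
        omega
      have h₁ := hle p.1 (by simp [incident])
      have h₂ := hle p.2 (by simp [incident])
      refine (ih (p :: es) (by rcases h.2 with (h | h) | h <;> first | exact h | omega)
        fun q hq => ?_).mono hperm.symm.subset
      rw [deg, deg, hperm.countP_eq, hperm.countP_eq]
      exact hdeg q (List.mem_cons_of_mem _ hq)

/-- The pairs `(a, b)` with `1 ≤ a < b < n`. -/
def pairs (n : ℕ) : List (ℕ × ℕ) :=
  (List.range n ×ˢ List.range n).filter fun p => Nat.blt 0 p.1 && Nat.blt p.1 p.2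

theorem mem_pairs {n : ℕ} {p : ℕ × ℕ} : p ∈ pairs n ↔ 0 < p.1 ∧ p.1 < p.2 ∧ p.2 < n := by
  rw [pairs, List.mem_filter, ← Prod.mk.eta (p := p), List.mem_product]
  simp only [List.mem_range, Bool.and_eq_true, Nat.blt_eq]
  omega

theorem nodup_pairs (n : ℕ) : (pairs n).Nodup :=
  (List.nodup_range.product List.nodup_range).filter _

theorem searchAll_four : searchAll (pairs 4) [(0, 1), (0, 2), (0, 3)] = true := by
  decide +kernel

theorem searchAll_six : searchAll (pairs 6) [(0, 1), (0, 2), (0, 3)] = true := by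
  decide +kernel

theorem searchAll_eight : searchAll (pairs 8) [(0, 1), (0, 2), (0, 3)] = true := by
  decide +kernel

/-- `L` lists every edge of `G` exactly once, as an increasing pair of vertex labels. -/
structure IsEdgeList {V : Type*} (G : SimpleGraph V) (l : V → ℕ) (L : List (ℕ × ℕ)) : Prop where
  injective : Function.Injective l
  nodup : L.Nodup
  mem_iff : ∀ p, p ∈ L ↔ p.1 < p.2 ∧ ∃ u v, G.Adj u v ∧ l u = p.1 ∧ l v = p.2

theorem IsEdgeList.min_max_mem {V : Type*} {G : SimpleGraph V} {l : V → ℕ} {L : List (ℕ × ℕ)}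
    (h : IsEdgeList G l L) {u v : V} (huv : G.Adj u v) :
    (min (l u) (l v), max (l u) (l v)) ∈ L := by
  rw [h.mem_iff]
  have hne : l u ≠ l v := fun he => huv.ne (h.injective he)
  rcases lt_or_gt_of_ne hne with hlt | hlt
  · exact ⟨by simpa using hlt.ne', u, v, huv, by simp [hlt.le], by simp [hlt.le]⟩
  · exact ⟨by simpa using hlt.ne, v, u, huv.symm, by simp [hlt.le], by simp [hlt.le]⟩

theorem IsEdgeList.deg_eq_degree {V : Type*} [Fintype V] {G : SimpleGraph V}
    [DecidableRel G.Adj] {l : V → ℕ} {L : List (ℕ × ℕ)} (h : IsEdgeList G l L) (v : V) :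
    deg (l v) L = G.degree v := by
  rw [deg, List.countP_eq_length_filter, ← List.toFinset_card_of_nodup (h.nodup.filter _),
    ← G.card_neighborFinset_eq_degree]
  symm
  refine Finset.card_bij (fun w _ => (min (l v) (l w), max (l v) (l w))) ?_ ?_ ?_
  · intro w hw
    rw [SimpleGraph.mem_neighborFinset] at hw
    rw [List.mem_toFinset, List.mem_filter]
    refine ⟨h.min_max_mem hw, ?_⟩
    simp only [incident, Bool.or_eq_true, beq_iff_eq]
    omega
  · intro w _ w' _ he
    rw [Prod.mk.injEq] at he
    exact h.injective (by omega)
  · rintro ⟨a, b⟩ hp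
    rw [List.mem_toFinset, List.mem_filter, h.mem_iff] at hp
    obtain ⟨⟨hlt, x, y, hxy, rfl, rfl⟩, hv⟩ := hp
    simp only [incident, Bool.or_eq_true, beq_iff_eq] at hlt hv
    rcases hv with hv | hv
    · obtain rfl := h.injective hv
      exact ⟨y, by simpa using hxy, by simp [hlt.le]⟩
    · obtain rfl := h.injective hv
      exact ⟨x, by simpa using hxy.symm, by simp [hlt.le]⟩

theorem IsEdgeList.exists_isProperEdgeColoring {V : Type*} {G : SimpleGraph V} {l : V → ℕ}
    {L : List (ℕ × ℕ)} (h : IsEdgeList G l L) (hL : EdgeColorable L) :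
    ∃ c : Sym2 V → Fin 3, IsProperEdgeColoring G c := by
  obtain ⟨c, hc⟩ := hL
  refine ⟨fun e => c ((e.map l).inf, (e.map l).sup), ?_⟩
  rintro e₁ he₁ e₂ he₂ hne ⟨v, hv₁, hv₂⟩
  obtain ⟨x, rfl⟩ := Sym2.mem_iff_exists.1 hv₁
  obtain ⟨y, rfl⟩ := Sym2.mem_iff_exists.1 hv₂
  rw [SimpleGraph.mem_edgeSet] at he₁ he₂
  change c (min (l v) (l x), max (l v) (l x)) ≠ c (min (l v) (l y), max (l v) (l y))
  refine hc _ (h.min_max_mem he₁) _ (h.min_max_mem he₂) (fun he => hne ?_) ?_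
  · rw [Prod.mk.injEq] at he
    rw [h.injective (a₁ := x) (a₂ := y) (by omega)]
  · simp only [touch, incident, Bool.or_eq_true, beq_iff_eq]
    omega

/-- The vertices of a finite graph can be labelled by `0, …, n - 1` in such a way that the
neighbors of some vertex of degree 3 are labelled `1, 2, 3` and the vertex itself `0`. -/
theorem exists_labelling {V : Type*} [Fintype V] (G : SimpleGraph V) [DecidableRel G.Adj] (v : V)
    (hv : G.degree v = 3) :
    ∃ l : V → ℕ, Function.Injective l ∧ (∀ w, l w < Fintype.card V) ∧ l v = 0 ∧
      ∀ k, (∃ w, G.Adj v w ∧ l w = k) ↔ k = 1 ∨ k = 2 ∨ k = 3 := by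
  classical
  rw [← G.card_neighborFinset_eq_degree, Finset.card_eq_three] at hv
  obtain ⟨a, b, c, hab, hac, hbc, hN⟩ := hv
  have hadj (w : V) : G.Adj v w ↔ w = a ∨ w = b ∨ w = c := by
    rw [← SimpleGraph.mem_neighborFinset, hN]
    simp
  have hva : v ≠ a := ((hadj a).2 (by simp)).ne
  have hvb : v ≠ b := ((hadj b).2 (by simp)).ne
  have hvc : v ≠ c := ((hadj c).2 (by simp)).ne
  let L : List V := v :: a :: b :: c :: (Finset.univ \ {v, a, b, c} : Finset V).toList
  have hmem (w : V) : w ∈ L := by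
    simp only [L, List.mem_cons, Finset.mem_toList, Finset.mem_sdiff, Finset.mem_univ,
      Finset.mem_insert, Finset.mem_singleton]
    tauto
  have hnodup : L.Nodup := by
    simp [L, hva, hvb, hvc, hab, hac, hbc, Finset.nodup_toList]
  have hlen : L.length = Fintype.card V := by
    rw [← List.toFinset_card_of_nodup hnodup, Finset.eq_univ_iff_forall.2 fun w =>
      List.mem_toFinset.2 (hmem w), Finset.card_univ]
  have ha : L.idxOf a = 1 := by simp [L, List.idxOf_cons_ne, hva]
  have hb : L.idxOf b = 2 := by simp [L, List.idxOf_cons_ne, hvb, hab]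
  have hc : L.idxOf c = 3 := by simp [L, List.idxOf_cons_ne, hvc, hac, hbc]
  refine ⟨fun w => L.idxOf w, fun x y hxy => (List.idxOf_inj (hmem x)).1 hxy,
    fun w => hlen ▸ List.idxOf_lt_length_of_mem (hmem w), by simp [L], fun k => ?_⟩
  simp only [hadj]
  constructor
  · rintro ⟨w, rfl | rfl | rfl, rfl⟩ <;> simp [ha, hb, hc]
  · rintro (rfl | rfl | rfl)
    exacts [⟨a, by simp, ha⟩, ⟨b, by simp, hb⟩, ⟨c, by simp, hc⟩]

theorem card_of_cubic {V : Type*} [Fintype V] [Nonempty V] (G : SimpleGraph V)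
    [DecidableRel G.Adj] (hG : ∀ v, G.degree v = 3) (hcard : Fintype.card V < 10) :
    Fintype.card V = 4 ∨ Fintype.card V = 6 ∨ Fintype.card V = 8 := by
  have hlt := G.degree_lt_card_verts (Classical.arbitrary V)
  have hsum := G.sum_degrees_eq_twice_card_edges
  simp only [hG, Finset.sum_const, Finset.card_univ, smul_eq_mul] at hlt hsum
  omega

theorem searchAll_pairs {n : ℕ} (hn : n = 4 ∨ n = 6 ∨ n = 8) :
    searchAll (pairs n) [(0, 1), (0, 2), (0, 3)] = true := by
  rcases hn with rfl | rfl | rfl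
  exacts [searchAll_four, searchAll_six, searchAll_eight]

theorem exists_isProperEdgeColoring_of_cubic {V : Type*} [Fintype V] (G : SimpleGraph V)
    [DecidableRel G.Adj] (hG : ∀ v, G.degree v = 3) (hcard : Fintype.card V < 10) :
    ∃ c : Sym2 V → Fin 3, IsProperEdgeColoring G c := by
  classical
  cases isEmpty_or_nonempty V with
  | inl _ => exact ⟨fun _ => 0, fun _ _ _ _ _ ⟨v, _⟩ => isEmptyElim v⟩
  | inr hV =>
    obtain ⟨v₀⟩ := id hV
    obtain ⟨l, hl, hlt, h₀, hN⟩ := exists_labelling G v₀ (hG v₀)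
    let A : ℕ × ℕ → Bool := fun p => decide (∃ u v, G.Adj u v ∧ l u = p.1 ∧ l v = p.2)
    have hL : IsEdgeList G l ((pairs (Fintype.card V)).filter A ++ [(0, 1), (0, 2), (0, 3)]) := by
      refine ⟨hl, List.Nodup.append ((nodup_pairs _).filter _) (by decide) ?_, fun p => ?_⟩
      · intro p hp hp'
        have h := (mem_pairs.1 (List.mem_of_mem_filter hp)).1
        simp only [List.mem_cons, List.not_mem_nil, or_false] at hp'
        rcases hp' with rfl | rfl | rfl <;> exact absurd h (lt_irrefl 0)
      · obtain ⟨a, b⟩ := p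
        have hstar : (a, b) ∈ [(0, 1), (0, 2), (0, 3)] ↔
            a = 0 ∧ ∃ w, G.Adj v₀ w ∧ l w = b := by
          rw [hN]
          simp only [List.mem_cons, List.not_mem_nil, or_false, Prod.mk.injEq]
          tauto
        rw [List.mem_append, hstar, List.mem_filter, mem_pairs, decide_eq_true_eq]
        constructor
        · rintro (⟨⟨-, h, -⟩, h'⟩ | ⟨rfl, w, hw, rfl⟩)
          · exact ⟨h, h'⟩
          · have hne : l w ≠ l v₀ := fun h => hw.ne (hl h).symm
            exact ⟨by simp only; omega, v₀, w, hw, h₀, rfl⟩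
        · rintro ⟨h, u, w, huw, rfl, rfl⟩
          rcases Nat.eq_zero_or_pos (l u) with hu | hu
          · obtain rfl := hl (hu.trans h₀.symm)
            exact .inr ⟨hu, w, huw, rfl⟩
          · exact .inl ⟨⟨hu, h, hlt w⟩, u, w, huw, rfl, rfl⟩
    have hsurj (k : ℕ) (hk : k < Fintype.card V) : ∃ v, l v = k := by
      have hbij : Function.Bijective fun v => (⟨l v, hlt v⟩ : Fin (Fintype.card V)) :=
        (Fintype.bijective_iff_injective_and_card _).2
          ⟨fun x y h => hl (Fin.mk.inj h), by simp⟩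
      obtain ⟨v, hv⟩ := hbij.2 ⟨k, hk⟩
      exact ⟨v, Fin.mk.inj hv⟩
    refine hL.exists_isProperEdgeColoring (edgeColorable_of_searchAll A _ _
      (searchAll_pairs (card_of_cubic G hG hcard)) fun p hp => ?_)
    obtain ⟨-, h₁₂, h₂⟩ := mem_pairs.1 hp
    obtain ⟨u, hu⟩ := hsurj p.1 (h₁₂.trans h₂)
    obtain ⟨w, hw⟩ := hsurj p.2 h₂
    rw [← hu, ← hw, hL.deg_eq_degree, hL.deg_eq_degree]
    exact ⟨hG u, hG w⟩

end CubicEdgeColoring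

/-- The Petersen graph is the smallest snark: every bridgeless cubic simple graph with fewer
than 10 vertices is 3-edge-colorable. -/
theorem bridgeless_cubic_lt_ten_vertices_three_edge_colorable
    {V : Type*} [Fintype V] (G : SimpleGraph V) [DecidableRel G.Adj]
    (hcubic : ∀ v : V, G.degree v = 3)
    (hbridgeless : ∀ e : Sym2 V, ¬ G.IsBridge e)
    (hcard : Fintype.card V < 10) :
    ∃ c : Sym2 V → Fin 3, IsProperEdgeColoring G c := by
  exact CubicEdgeColoring.exists_isProperEdgeColoring_of_cubic G hcubic hcard
end

section
/- Quadrilateral insertion preserves 3-edge-colorability: let G' be a finite cubic simple graph that is 3-edge-colorable, let {v1,v2} be an edge of G', let v7 be a neighbor of v2 with v7 ≠ v1, and let v8 be a neighbor of v1 with v8 ≠ v2. Let G be the graph obtained from G' by deleting the edges {v2,v7} and {v1,v8}, adding two new vertices x and y, and adding the edges {v2,x}, {x,v7}, {v1,y}, {y,v8}, and {x,y} (so that v1, v2, x, y form a 4-cycle in G). Then G is a cubic simple graph and G is 3-edge-colorable. -/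
open Finset in
theorem SimpleGraph.Connected.exists_unique_other_leaf {V : Type*} [Fintype V] [DecidableEq V]
    {K : SimpleGraph V} [DecidableRel K.Adj] (hK : K.Connected)
    (hdeg : ∀ v, K.degree v = 1 ∨ K.degree v = 2) {v : V} (hv : K.degree v = 1) :
    ∃ v' ≠ v, ∀ w, K.degree w = 1 ↔ w = v ∨ w = v' := by
  have hle := hK.card_vert_le_card_edgeSet_add_one
  have hsum := K.sum_degrees_eq_twice_card_edges
  have hcount : ∑ w, K.degree w + #{w | K.degree w = 1} = 2 * Fintype.card V := by
    rw [card_filter, ← sum_add_distrib, Fintype.card, mul_comm, ← smul_eq_mul, ← sum_const]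
    refine sum_congr rfl fun w _ => ?_
    rcases hdeg w with h | h <;> simp [h]
  rw [Nat.card_eq_fintype_card, Nat.card_eq_fintype_card, ← SimpleGraph.edgeFinset_card] at hle
  have hpos : 0 < #{w | K.degree w = 1} := card_pos.2 ⟨v, by simpa using hv⟩
  obtain ⟨a, b, hab, h⟩ := card_eq_two.1 (show #{w | K.degree w = 1} = 2 by omega)
  have hmem : ∀ w, K.degree w = 1 ↔ w = a ∨ w = b := fun w => by
    simpa using Finset.ext_iff.1 h w
  rcases (hmem v).1 hv with rfl | rfl
  · exact ⟨b, hab.symm, hmem⟩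
  · exact ⟨a, hab, fun w => (hmem w).trans or_comm⟩

theorem isProperEdgeColoring_iff {V γ : Type*} {G : SimpleGraph V} {c : Sym2 V → γ} :
    IsProperEdgeColoring G c ↔
      ∀ v a b, G.Adj v a → G.Adj v b → a ≠ b → c s(v, a) ≠ c s(v, b) := by
  constructor
  · intro h v a b ha hb hab
    exact h _ ha _ hb (fun h => hab (Sym2.congr_right.1 h)) ⟨v, by simp, by simp⟩
  · rintro h e₁ h₁ e₂ h₂ hne ⟨v, hv₁, hv₂⟩
    obtain ⟨a, rfl⟩ := Sym2.mem_iff_exists.1 hv₁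
    obtain ⟨b, rfl⟩ := Sym2.mem_iff_exists.1 hv₂
    exact h v a b h₁ h₂ (by rintro rfl; exact hne rfl)

/-- A swap of the colors `b` and `d` along the Kempe chain starting at `v`. -/
theorem exists_kempe_swap {V : Type*} [Fintype V] [DecidableEq V] {γ : Type*} [DecidableEq γ]
    {H : SimpleGraph V} {c : Sym2 V → γ} (hc : IsProperEdgeColoring H c) (b d : γ)
    (hdeg : ∀ v, {w | H.Adj v w ∧ (c s(v, w) = b ∨ c s(v, w) = d)}.ncard = 1 ∨
      {w | H.Adj v w ∧ (c s(v, w) = b ∨ c s(v, w) = d)}.ncard = 2)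
    {v : V} (hv : {w | H.Adj v w ∧ (c s(v, w) = b ∨ c s(v, w) = d)}.ncard = 1) :
    ∃ v' ≠ v, {w | H.Adj v' w ∧ (c s(v', w) = b ∨ c s(v', w) = d)}.ncard = 1 ∧
      ∃ c' : Sym2 V → γ, IsProperEdgeColoring H c' ∧
        ∀ u w, {w | H.Adj u w ∧ (c s(u, w) = b ∨ c s(u, w) = d)}.ncard = 1 → H.Adj u w →
          c' s(u, w) = if u = v ∨ u = v' then Equiv.swap b d (c s(u, w)) else c s(u, w) := by
  classical
  let K : SimpleGraph V :=
    { Adj := fun u w => H.Adj u w ∧ (c s(u, w) = b ∨ c s(u, w) = d)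
      symm := ⟨fun u w h => by rw [Sym2.eq_swap]; exact ⟨h.1.symm, h.2⟩⟩
      loopless := ⟨fun u h => H.loopless.irrefl u h.1⟩ }
  let C := K.connectedComponentMk v
  have hclosed : ∀ {u w}, K.Adj u w → (u ∈ C ↔ w ∈ C) := fun h => C.mem_supp_congr_adj h
  have hCdeg : ∀ u : C, C.toSimpleGraph.degree u =
      {w | H.Adj u w ∧ (c s((u : V), w) = b ∨ c s((u : V), w) = d)}.ncard := fun u => by
    rw [← SimpleGraph.card_neighborFinset_eq_degree,
      ← Finset.card_map (Function.Embedding.subtype _), ← Set.ncard_coe_finset]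
    congr 1
    ext w
    simp only [Finset.coe_map, SimpleGraph.coe_neighborFinset, Set.mem_image,
      SimpleGraph.mem_neighborSet, Set.mem_ofPred_eq]
    constructor
    · rintro ⟨w, h, rfl⟩
      exact h
    · intro h
      exact ⟨⟨w, (hclosed (u := u) (w := w) h).1 u.2⟩, h, rfl⟩
  have hvC : v ∈ C := rfl
  obtain ⟨⟨v', hv'C⟩, hne, hend⟩ :=
    C.connected_toSimpleGraph.exists_unique_other_leaf (v := ⟨v, hvC⟩)
      (fun u => by rw [hCdeg]; exact hdeg u) (by rw [hCdeg]; exact hv)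
  let c' : Sym2 V → γ := fun e => if ∃ p ∈ e, p ∈ C then Equiv.swap b d (c e) else c e
  have hc' : ∀ u w, H.Adj u w →
      c' s(u, w) = if u ∈ C then Equiv.swap b d (c s(u, w)) else c s(u, w) := by
    intro u w h
    by_cases hK : c s(u, w) = b ∨ c s(u, w) = d
    · have := hclosed (u := u) (w := w) ⟨h, hK⟩
      simp [c', this]
    · have := Equiv.swap_apply_of_ne_of_ne (fun h => hK (.inl h)) (fun h => hK (.inr h))
      simp [c', this]
  refine ⟨v', fun h => hne (Subtype.ext h), ?_, c', ?_, ?_⟩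
  · have := (hend ⟨v', hv'C⟩).2 (.inr rfl)
    rwa [hCdeg] at this
  · rw [isProperEdgeColoring_iff] at hc ⊢
    intro u w₁ w₂ h₁ h₂ hne
    have := hc u w₁ w₂ h₁ h₂ hne
    rw [hc' _ _ h₁, hc' _ _ h₂]
    split_ifs
    · simpa using this
    · exact this
  · intro u w hu h
    rw [hc' _ _ h]
    congr 1
    rw [eq_iff_iff]
    constructor
    · intro huC
      have := (hend ⟨u, huC⟩).1 (by rw [hCdeg]; exact hu)
      simpa using this
    · rintro (rfl | rfl)
      · exact hvC
      · exact hv'C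

/-- A proper 3-edge-coloring of the complement of a 4-cycle extends to the 4-cycle when the colors
at its vertices agree in neighboring pairs. -/
theorem exists_extension_of_pairs {V : Type*} [DecidableEq V] {G : SimpleGraph V}
    {s t : Fin 4 → V} (hs : Function.Injective s) (ht : ∀ i j, t i ≠ s j)
    (hadj : ∀ i w, G.Adj (s i) w ↔ w = s (i + 1) ∨ w = s (i + 3) ∨ w = t i)
    {c : Sym2 V → Fin 3}
    (hc : ∀ v, (∀ i, v ≠ s i) → ∀ a b, G.Adj v a → G.Adj v b → a ≠ b → c s(v, a) ≠ c s(v, b))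
    (hpairs : c s(s 0, t 0) = c s(s 1, t 1) ∧ c s(s 2, t 2) = c s(s 3, t 3) ∨
      c s(s 0, t 0) = c s(s 3, t 3) ∧ c s(s 1, t 1) = c s(s 2, t 2)) :
    ∃ c' : Sym2 V → Fin 3, IsProperEdgeColoring G c' := by
  have hq : ∀ p : Fin 4 → Fin 3, (p 0 = p 1 ∧ p 2 = p 3 ∨ p 0 = p 3 ∧ p 1 = p 2) →
      ∃ q₀ q₁ q₂ q₃ : Fin 3,
        (q₀ ≠ q₁ ∧ q₀ ≠ p 1 ∧ q₁ ≠ p 1) ∧ (q₁ ≠ q₂ ∧ q₁ ≠ p 2 ∧ q₂ ≠ p 2) ∧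
        (q₂ ≠ q₃ ∧ q₂ ≠ p 3 ∧ q₃ ≠ p 3) ∧ (q₃ ≠ q₀ ∧ q₃ ≠ p 0 ∧ q₀ ≠ p 0) := by
    intro p
    generalize p 0 = a, p 1 = b, p 2 = c, p 3 = d
    rintro (⟨rfl, rfl⟩ | ⟨rfl, rfl⟩)
    all_goals
      revert a
      decide +revert
  obtain ⟨q₀, q₁, q₂, q₃, h₁, h₂, h₃, h₀⟩ := hq (fun i => c s(s i, t i)) hpairs
  let c' : Sym2 V → Fin 3 := fun e =>
    if e = s(s 0, s 1) then q₀ else if e = s(s 1, s 2) then q₁ else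
    if e = s(s 2, s 3) then q₂ else if e = s(s 3, s 0) then q₃ else c e
  have hc' : ∀ v w, (∀ i, v ≠ s i) → c' s(v, w) = c s(v, w) := by
    intro v w h
    simp [c', h]
  refine ⟨c', isProperEdgeColoring_iff.2 ?_⟩
  intro v a b ha hb hab
  by_cases hv : ∃ i, v = s i
  · obtain ⟨i, rfl⟩ := hv
    have ht' : c' s(s i, t i) = c s(s i, t i) := by
      rw [Sym2.eq_swap, hc' _ _ (ht i)]
    rw [hadj] at ha hb
    have e₀ : c' s(s 0, s 1) = q₀ := by simp [c']
    have e₁ : c' s(s 1, s 2) = q₁ := by simp [c', hs.eq_iff]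
    have e₂ : c' s(s 2, s 3) = q₂ := by simp [c', hs.eq_iff]
    have e₃ : c' s(s 3, s 0) = q₃ := by simp [c', hs.eq_iff]
    have e₀' : c' s(s 1, s 0) = q₀ := by rwa [Sym2.eq_swap]
    have e₁' : c' s(s 2, s 1) = q₁ := by rwa [Sym2.eq_swap]
    have e₂' : c' s(s 3, s 2) = q₂ := by rwa [Sym2.eq_swap]
    have e₃' : c' s(s 0, s 3) = q₃ := by rwa [Sym2.eq_swap]
    clear_value c'
    clear hc hc' hq hpairs hadj
    fin_cases i <;> simp only [Fin.reduceFinMk, Fin.reduceAdd, Fin.isValue] at ha hb ht' ⊢ <;>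
      rcases ha with rfl | rfl | rfl <;> rcases hb with rfl | rfl | rfl <;>
      first | exact absurd rfl hab | (simp only [e₀, e₁, e₂, e₃, e₀', e₁', e₂', e₃', ht']; grind only)
  · push Not at hv
    rw [hc' _ _ hv, hc' _ _ hv]
    exact hc v hv a b ha hb hab

/-- A proper 3-edge-coloring of the complement of a 4-cycle of a cubic graph can be turned into
one of the whole graph when the colors at opposite vertices of the 4-cycle agree. -/
theorem exists_coloring_of_opposite {V : Type*} [Fintype V] [DecidableEq V] {G : SimpleGraph V}
    {s t : Fin 4 → V} (hs : Function.Injective s) (ht : ∀ i j, t i ≠ s j)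
    (hadj : ∀ i w, G.Adj (s i) w ↔ w = s (i + 1) ∨ w = s (i + 3) ∨ w = t i)
    (hcubic : ∀ v, (G.neighborSet v).ncard = 3) {c : Sym2 V → Fin 3}
    (hc : ∀ v, (∀ i, v ≠ s i) → ∀ a b, G.Adj v a → G.Adj v b → a ≠ b → c s(v, a) ≠ c s(v, b))
    (h02 : c s(s 0, t 0) = c s(s 2, t 2)) (h13 : c s(s 1, t 1) = c s(s 3, t 3)) :
    ∃ c' : Sym2 V → Fin 3, IsProperEdgeColoring G c' := by
  by_cases h01 : c s(s 0, t 0) = c s(s 1, t 1)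
  · exact exists_extension_of_pairs hs ht hadj hc (.inl ⟨h01, by rw [← h02, ← h13, h01]⟩)
  set b := c s(s 0, t 0) with hb
  set d := c s(s 1, t 1) with hd
  let H : SimpleGraph V :=
    { Adj := fun u w => G.Adj u w ∧ ¬ ((∃ i, u = s i) ∧ ∃ i, w = s i)
      symm := ⟨fun u w h => ⟨h.1.symm, fun h' => h.2 h'.symm⟩⟩
      loopless := ⟨fun u h => G.loopless.irrefl u h.1⟩ }
  have hHs : ∀ i w, H.Adj (s i) w ↔ w = t i := by
    intro i w
    constructor
    · rintro ⟨h, h'⟩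
      rcases (hadj i w).1 h with rfl | rfl | rfl
      · exact absurd ⟨⟨_, rfl⟩, ⟨_, rfl⟩⟩ h'
      · exact absurd ⟨⟨_, rfl⟩, ⟨_, rfl⟩⟩ h'
      · rfl
    · rintro rfl
      exact ⟨(hadj i _).2 (.inr (.inr rfl)), fun h => h.2.elim fun j => ht i j⟩
  have hHn : ∀ v, (∀ i, v ≠ s i) → ∀ w, H.Adj v w ↔ G.Adj v w := fun v hv w =>
    ⟨fun h => h.1, fun h => ⟨h, fun h' => h'.1.elim hv⟩⟩
  have hHc : IsProperEdgeColoring H c := by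
    rw [isProperEdgeColoring_iff]
    intro v x y hx hy hxy
    by_cases hv : ∃ i, v = s i
    · obtain ⟨i, rfl⟩ := hv
      exact absurd (((hHs i x).1 hx).trans ((hHs i y).1 hy).symm) hxy
    · push Not at hv
      exact hc v hv x y hx.1 hy.1 hxy
  have hcs : ∀ i, c s(s i, t i) = b ∨ c s(s i, t i) = d := by
    intro i
    fin_cases i
    exacts [.inl rfl, .inr rfl, .inl h02.symm, .inr h13.symm]
  have hdegs : ∀ i, {w | H.Adj (s i) w ∧ (c s(s i, w) = b ∨ c s(s i, w) = d)}.ncard = 1 := by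
    intro i
    rw [Set.ncard_eq_one]
    refine ⟨t i, Set.ext fun w => ?_⟩
    simp only [hHs, Set.mem_ofPred_eq, Set.mem_singleton_iff]
    exact ⟨fun h => h.1, by rintro rfl; exact ⟨rfl, hcs i⟩⟩
  have hdegn : ∀ v, (∀ i, v ≠ s i) →
      {w | H.Adj v w ∧ (c s(v, w) = b ∨ c s(v, w) = d)}.ncard = 2 := by
    intro v hv
    have hinj : Set.InjOn (fun w => c s(v, w)) (G.neighborSet v) := fun x hx y hy h =>
      by_contra fun hxy => hc v hv x y hx hy hxy h
    have himg : (fun w => c s(v, w)) '' G.neighborSet v = Set.univ :=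
      Set.eq_of_subset_of_ncard_le (Set.subset_univ _)
        (by rw [hinj.ncard_image, hcubic, Set.ncard_univ]; simp)
    rw [← Set.ncard_pair h01, ← (hinj.mono (fun w h => h.1.1)).ncard_image]
    congr 1
    ext k
    simp only [hHn v hv, Set.mem_image, Set.mem_ofPred_eq, Set.mem_insert_iff,
      Set.mem_singleton_iff]
    constructor
    · rintro ⟨w, ⟨-, h⟩, rfl⟩
      exact h
    · intro hk
      obtain ⟨w, hw, rfl⟩ := himg.ge (Set.mem_univ k)
      exact ⟨w, ⟨hw, hk⟩, rfl⟩
  obtain ⟨v', hne, hv', c', hc', hswap⟩ := exists_kempe_swap hHc b d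
    (fun v => by
      by_cases hv : ∃ i, v = s i
      · obtain ⟨i, rfl⟩ := hv
        exact .inl (hdegs i)
      · push Not at hv
        exact .inr (hdegn v hv)) (hdegs 0)
  obtain ⟨j, rfl⟩ : ∃ j, v' = s j := by
    by_contra! h
    have := hdegn v' h
    omega
  rw [isProperEdgeColoring_iff] at hc'
  refine exists_extension_of_pairs (c := c') hs ht hadj
    (fun v hv x y hx hy => hc' v x y ((hHn v hv x).2 hx) ((hHn v hv y).2 hy)) ?_
  have hcol := fun i => hswap (s i) (t i) (hdegs i) ((hHs i _).2 rfl)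
  simp only [hcol, hs.eq_iff, ← h02, ← h13, ← hb, ← hd]
  fin_cases j <;> simp at hne ⊢

theorem exists_third_neighbor {V : Type*} [Fintype V] [DecidableEq V] {G : SimpleGraph V}
    [DecidableRel G.Adj] {v a b : V} (hv : G.degree v = 3) (ha : G.Adj v a) (hb : G.Adj v b)
    (hab : a ≠ b) : ∃ u, u ≠ a ∧ u ≠ b ∧ ∀ w, G.Adj v w ↔ w = a ∨ w = b ∨ w = u := by
  have hsub : {a, b} ⊆ G.neighborFinset v := by
    simp [Finset.insert_subset_iff, ha, hb]
  have hcard : (G.neighborFinset v \ {a, b}).card = 1 := by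
    rw [Finset.card_sdiff_of_subset hsub, Finset.card_pair hab,
      SimpleGraph.card_neighborFinset_eq_degree, hv]
  obtain ⟨u, hu⟩ := Finset.card_eq_one.1 hcard
  have hmem : ∀ w, G.Adj v w ∧ ¬ (w = a ∨ w = b) ↔ w = u := fun w => by
    simpa using Finset.ext_iff.1 hu w
  have hu' := ((hmem u).2 rfl).2
  refine ⟨u, fun h => hu' (.inl h), fun h => hu' (.inr h), fun w => ?_⟩
  have hw := hmem w
  have h₁ : w = a → G.Adj v w := fun h => h ▸ ha
  have h₂ : w = b → G.Adj v w := fun h => h ▸ hb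
  tauto

/-- Quadrilateral insertion preserves 3-edge-colorability: if `G'` is a 3-edge-colorable finite
cubic simple graph, `{v₁,v₂}` is an edge of `G'`, `v₇` is a neighbor of `v₂` with `v₇ ≠ v₁`,
`v₈` is a neighbor of `v₁` with `v₈ ≠ v₂`, and `G` is obtained from `G'` by deleting the edges
`{v₂,v₇}` and `{v₁,v₈}`, adding two new vertices `x = inr 0` and `y = inr 1`, and adding the
edges `{v₂,x}, {x,v₇}, {v₁,y}, {y,v₈}, {x,y}` (so `v₁, v₂, x, y` form a 4-cycle in `G`), then
`G` is a cubic simple graph and is 3-edge-colorable. -/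
theorem quadrilateral_insertion_preserves_three_edge_colorability
    {V : Type*} [Fintype V] [DecidableEq V] (G' : SimpleGraph V) [DecidableRel G'.Adj]
    (hcubic : ∀ x : V, G'.degree x = 3)
    (hcol : ∃ c : Sym2 V → Fin 3, IsProperEdgeColoring G' c)
    (v₁ v₂ v₇ v₈ : V)
    (h12 : G'.Adj v₁ v₂) (h27 : G'.Adj v₂ v₇) (h71 : v₇ ≠ v₁)
    (h18 : G'.Adj v₁ v₈) (h82 : v₈ ≠ v₂)
    (G : SimpleGraph (V ⊕ Fin 2))
    (hG : G = SimpleGraph.fromEdgeSet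
      ((Sym2.map Sum.inl '' (G'.edgeSet \ {s(v₂, v₇), s(v₁, v₈)})) ∪
        {s(Sum.inl v₂, Sum.inr 0), s(Sum.inr 0, Sum.inl v₇),
         s(Sum.inl v₁, Sum.inr 1), s(Sum.inr 1, Sum.inl v₈),
         s(Sum.inr 0, Sum.inr 1)})) :
    (∀ z : V ⊕ Fin 2, Nat.card (G.neighborSet z) = 3) ∧
    ∃ c : Sym2 (V ⊕ Fin 2) → Fin 3, IsProperEdgeColoring G c := by
  obtain ⟨c, hc⟩ := hcol
  rw [isProperEdgeColoring_iff] at hc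
  obtain ⟨u₁, hu₁₂, hu₁₈, hn₁⟩ := exists_third_neighbor (hcubic v₁) h12 h18 h82.symm
  obtain ⟨u₂, hu₂₁, hu₂₇, hn₂⟩ := exists_third_neighbor (hcubic v₂) h12.symm h27 h71.symm
  have hu₁ : G'.Adj v₁ u₁ := (hn₁ _).2 (.inr (.inr rfl))
  have hu₂ : G'.Adj v₂ u₂ := (hn₂ _).2 (.inr (.inr rfl))
  have hne12 := h12.ne
  have hne27 := h27.ne
  have hne18 := h18.ne
  have hne₁ := hu₁.ne
  have hne₂ := hu₂.ne
  have hll : ∀ u w, G.Adj (.inl u) (.inl w) ↔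
      G'.Adj u w ∧ s(u, w) ≠ s(v₂, v₇) ∧ s(u, w) ≠ s(v₁, v₈) := by
    intro u w
    have himg : s(Sum.inl u, Sum.inl w) ∈ Sym2.map (Sum.inl : V → V ⊕ Fin 2) ''
        (G'.edgeSet \ {s(v₂, v₇), s(v₁, v₈)}) ↔
        s(u, w) ∈ G'.edgeSet \ {s(v₂, v₇), s(v₁, v₈)} :=
      (Sym2.map.injective Sum.inl_injective).mem_set_image (a := s(u, w))
    rw [hG, SimpleGraph.fromEdgeSet_adj, Set.mem_union, himg]
    have : G'.Adj u w → u ≠ w := fun h => h.ne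
    simp
    tauto
  have hnot : ∀ (p : V ⊕ Fin 2) (i : Fin 2), s(p, Sum.inr i) ∉
      Sym2.map (Sum.inl : V → V ⊕ Fin 2) '' (G'.edgeSet \ {s(v₂, v₇), s(v₁, v₈)}) := by
    rintro p i ⟨e, -, he⟩
    induction e with
    | _ a b => simp at he
  have hlx : ∀ u, G.Adj (.inl u) (.inr 0) ↔ u = v₂ ∨ u = v₇ := by
    intro u
    rw [hG, SimpleGraph.fromEdgeSet_adj, Set.mem_union, or_iff_right (hnot _ _)]
    simp
  have hly : ∀ u, G.Adj (.inl u) (.inr 1) ↔ u = v₁ ∨ u = v₈ := by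
    intro u
    rw [hG, SimpleGraph.fromEdgeSet_adj, Set.mem_union, or_iff_right (hnot _ _)]
    simp
  have hxl : ∀ u, G.Adj (.inr 0) (.inl u) ↔ u = v₂ ∨ u = v₇ := fun u => by
    rw [SimpleGraph.adj_comm, hlx]
  have hyl : ∀ u, G.Adj (.inr 1) (.inl u) ↔ u = v₁ ∨ u = v₈ := fun u => by
    rw [SimpleGraph.adj_comm, hly]
  have hxy : G.Adj (.inr 0) (.inr 1) := by
    rw [hG, SimpleGraph.fromEdgeSet_adj, Set.mem_union, or_iff_right (hnot _ _)]
    simp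
  have hnx : ∀ w, G.Adj (.inr 0) w ↔ w = .inr 1 ∨ w = .inl v₂ ∨ w = .inl v₇ := by
    rintro (u | i)
    · simp [hxl]
    · fin_cases i <;> simp [hxy]
  have hny : ∀ w, G.Adj (.inr 1) w ↔ w = .inl v₁ ∨ w = .inr 0 ∨ w = .inl v₈ := by
    rintro (u | i)
    · simp [hyl]
    · fin_cases i <;> simp [hxy.symm]
  have hcard : ∀ z, (G.neighborSet z).ncard = 3 := by
    rintro (v | i)
    · let f : V → V ⊕ Fin 2 := fun w =>
        if s(v, w) = s(v₂, v₇) then .inr 0 else if s(v, w) = s(v₁, v₈) then .inr 1 else .inl w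
      have hf : Set.InjOn f (G'.neighborSet v) := by
        intro a _ b _ h
        simp only [f] at h
        split_ifs at h with h₁ h₂ h₃ h₄ h₅ h₆
        · exact Sym2.congr_right.1 (h₁.trans h₂.symm)
        all_goals simp at h
        · exact Sym2.congr_right.1 (h₄.trans h₆.symm)
        · exact h
      have himg : f '' G'.neighborSet v = G.neighborSet (.inl v) := by
        ext (w | i)
        · simp only [Set.mem_image, SimpleGraph.mem_neighborSet, hll, f]
          grind
        · fin_cases i
          · simp only [Set.mem_image, SimpleGraph.mem_neighborSet, Fin.zero_eta, hlx, f]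
            constructor
            · rintro ⟨w, hw, h⟩
              grind [Sym2.eq_iff]
            · rintro (rfl | rfl)
              · exact ⟨v₇, h27, by simp⟩
              · exact ⟨v₂, h27.symm, by simp⟩
          · simp only [Set.mem_image, SimpleGraph.mem_neighborSet, Fin.mk_one, hly, f]
            constructor
            · rintro ⟨w, hw, h⟩
              grind [Sym2.eq_iff]
            · rintro (rfl | rfl)
              · exact ⟨v₈, h18, by grind [Sym2.eq_iff]⟩
              · exact ⟨v₁, h18.symm, by grind [Sym2.eq_iff]⟩
      rw [← himg, hf.ncard_image, ← SimpleGraph.coe_neighborFinset, Set.ncard_coe_finset,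
        SimpleGraph.card_neighborFinset_eq_degree, hcubic]
    · rw [Set.ncard_eq_three]
      fin_cases i
      · exact ⟨.inr 1, .inl v₂, .inl v₇, by simp, by simp, by simpa using hne27,
          Set.ext fun w => by simpa using hnx w⟩
      · exact ⟨.inl v₁, .inr 0, .inl v₈, by simp, by simpa using hne18, by simp,
          Set.ext fun w => by simpa using hny w⟩
  refine ⟨hcard, ?_⟩
  let s : Fin 4 → V ⊕ Fin 2 := ![.inl v₁, .inl v₂, .inr 0, .inr 1]
  let t : Fin 4 → V ⊕ Fin 2 := ![.inl u₁, .inl u₂, .inl v₇, .inl v₈]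
  have hs : Function.Injective s := by
    intro i j h
    fin_cases i <;> fin_cases j <;> simp [s, hne12, hne12.symm] at h ⊢
  have ht : ∀ i j, t i ≠ s j := by
    intro i j
    fin_cases i <;> fin_cases j <;>
      simp [s, t, hu₁₂, hne₁.symm, hu₂₁, hne₂.symm, h71, hne27.symm, h82, hne18.symm]
  have hn₁' : ∀ w, G.Adj (.inl v₁) w ↔ w = .inl v₂ ∨ w = .inr 1 ∨ w = .inl u₁ := by
    rintro (w | i)
    · rw [hll, hn₁]
      simp
      grind
    · fin_cases i <;> simp [hlx, hly, hne12, h71.symm]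
  have hn₂' : ∀ w, G.Adj (.inl v₂) w ↔ w = .inr 0 ∨ w = .inl v₁ ∨ w = .inl u₂ := by
    rintro (w | i)
    · rw [hll, hn₂]
      simp
      grind
    · fin_cases i <;> simp [hlx, hly, hne12.symm, h82.symm]
  have hadj : ∀ i w, G.Adj (s i) w ↔ w = s (i + 1) ∨ w = s (i + 3) ∨ w = t i := by
    intro i
    fin_cases i
    exacts [hn₁', hn₂', hnx, hny]
  let π : V ⊕ Fin 2 → V := Sum.elim id ![v₂, v₁]
  have hcπ : ∀ v, (∀ i, v ≠ s i) → ∀ a b, G.Adj v a → G.Adj v b → a ≠ b →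
      c (Sym2.map π s(v, a)) ≠ c (Sym2.map π s(v, b)) := by
    rintro (v | i) hv a b ha hb hab
    · have hv₁ : v ≠ v₁ := fun h => hv 0 (by simp [s, h])
      have hv₂ : v ≠ v₂ := fun h => hv 1 (by simp [s, h])
      have key : ∀ w, G.Adj (.inl v) w → G'.Adj v (π w) ∧
          (w = .inl (π w) ∧ ¬ (v = v₇ ∧ π w = v₂) ∧ ¬ (v = v₈ ∧ π w = v₁) ∨
            w = .inr 0 ∧ v = v₇ ∧ π w = v₂ ∨ w = .inr 1 ∧ v = v₈ ∧ π w = v₁) := by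
        rintro (w | i) h
        · rw [hll] at h
          refine ⟨h.1, .inl ⟨rfl, ?_, ?_⟩⟩
          · rintro ⟨h₁, h₂⟩
            exact h.2.1 (Sym2.eq_iff.2 (.inr ⟨h₁, h₂⟩))
          · rintro ⟨h₁, h₂⟩
            exact h.2.2 (Sym2.eq_iff.2 (.inr ⟨h₁, h₂⟩))
        · fin_cases i
          · obtain rfl := ((hlx v).1 h).resolve_left hv₂
            exact ⟨h27.symm, .inr (.inl ⟨rfl, rfl, rfl⟩)⟩
          · obtain rfl := ((hly v).1 h).resolve_left hv₁
            exact ⟨h18.symm, .inr (.inr ⟨rfl, rfl, rfl⟩)⟩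
      obtain ⟨ha', ha⟩ := key a ha
      obtain ⟨hb', hb⟩ := key b hb
      exact hc v (π a) (π b) ha' hb' (by grind)
    · fin_cases i
      · exact absurd rfl (hv 2)
      · exact absurd rfl (hv 3)
  have a₁ := hc v₁ _ _ h12 h18 h82.symm
  have a₂ := hc v₁ _ _ h12 hu₁ hu₁₂.symm
  have a₃ := hc v₁ _ _ h18 hu₁ hu₁₈.symm
  have b₁ := hc v₂ _ _ h12.symm h27 h71.symm
  have b₂ := hc v₂ _ _ h12.symm hu₂ hu₂₁.symm
  have b₃ := hc v₂ _ _ h27 hu₂ hu₂₇.symm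
  rw [Sym2.eq_swap (a := v₂) (b := v₁)] at b₁ b₂
  by_cases h : c s(v₂, v₇) = c s(v₁, v₈)
  · refine exists_extension_of_pairs (c := c ∘ Sym2.map π) hs ht hadj hcπ (.inl ⟨?_, ?_⟩)
    · change c s(v₁, u₁) = c s(v₂, u₂)
      omega
    · exact h
  · refine exists_coloring_of_opposite (c := c ∘ Sym2.map π) hs ht hadj hcard hcπ ?_ ?_
    · change c s(v₁, u₁) = c s(v₂, v₇)
      omega
    · change c s(v₂, u₂) = c s(v₁, v₈)
      omega
end
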